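/- For each M < ∞ and ε ∈ (0,1) there exists a finite constant C = C(M,ε) such that the following holds. Let G = (V,E) be a finite connected graph with all degrees at most M in which TV_n > 0. Then for each integer n ≥ 1 there exists a partition 𝒫 of V into nonempty sets such that every cell W ∈ 𝒫 satisfies diam(W) ≤ min{2n, C·D_n*·log(1/TV_n)} and log|W| ≤ min{2Mn, C·(H_n* + log n)·log(1/TV_n)}, and such that the total degree of the vertices lying in cells W with |∂W| > C·ε^{−1}·TV_n·deg(W) is at most ε·deg(V). -/

import Mathlib

open scoped Classical BigOperators

namespace LazyRW

variable {V : Type*}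

/-- One-step transition kernel of the lazy simple random walk. -/
noncomputable def step (G : SimpleGraph V) [G.LocallyFinite] (x y : V) : ℝ :=
  if x = y then 1/2 else if G.Adj x y then 1 / (2 * (G.degree x)) else 0

/-- Probability of a given path of length `n` for the lazy walk started at `x`. -/
noncomputable def pathProb (G : SimpleGraph V) [G.LocallyFinite]
    (n : ℕ) (x : V) (p : Fin (n+1) → V) : ℝ :=
  (if p 0 = x then 1 else 0) * ∏ i : Fin n, step G (p i.castSucc) (p i.succ)

/-- Probability of an event determined by the first `n` steps of the lazy walk started at `x`. -/
noncomputable def walkProb (G : SimpleGraph V) [G.LocallyFinite]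
    (n : ℕ) (x : V) (E : Set (Fin (n+1) → V)) : ℝ :=
  ∑' p : (Fin (n+1) → V), pathProb G n x p * E.indicator (fun _ => (1:ℝ)) p

/-- Expectation of a functional of the first `n` steps of the lazy walk started at `x`. -/
noncomputable def walkExp (G : SimpleGraph V) [G.LocallyFinite]
    (n : ℕ) (x : V) (f : (Fin (n+1) → V) → ℝ) : ℝ :=
  ∑' p : (Fin (n+1) → V), pathProb G n x p * f p

/-- `n`-th power of the lazy transition matrix. -/
noncomputable def Pmat (G : SimpleGraph V) [G.LocallyFinite] : ℕ → V → V → ℝ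
  | 0, x, y => if x = y then 1 else 0
  | (n+1), x, y => ∑' z, Pmat G n x z * step G z y

/-- Total variation profile `TV_n`. -/
noncomputable def TV (G : SimpleGraph V) [G.LocallyFinite] (n : ℕ) : ℝ :=
  ⨆ e : {p : V × V // G.Adj p.1 p.2},
    (1/2) * ∑' z, |Pmat G n e.val.1 z - Pmat G n e.val.2 z|

/-- Expected graph-distance displacement at time `m`. -/
noncomputable def expDist (G : SimpleGraph V) [G.LocallyFinite] (m : ℕ) (x : V) : ℝ :=
  walkExp G m x (fun p => (G.dist (p 0) (p (Fin.last m)) : ℝ))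

/-- `D_n^*`: supremal expected displacement up to time `n`. -/
noncomputable def Dstar (G : SimpleGraph V) [G.LocallyFinite] (n : ℕ) : ℝ :=
  ⨆ x : V, ⨆ m : Fin (n+1), expDist G m.1 x

/-- Entropy of the walk at time `m` started at `x`. -/
noncomputable def entropy (G : SimpleGraph V) [G.LocallyFinite] (m : ℕ) (x : V) : ℝ :=
  ∑' y : V, Real.negMulLog (Pmat G m x y)

/-- `H_n^*`: supremal entropy up to time `n`. -/
noncomputable def Hstar (G : SimpleGraph V) [G.LocallyFinite] (n : ℕ) : ℝ :=
  ⨆ x : V, ⨆ m : Fin (n+1), entropy G m.1 x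

/-- `|∂W|`: the number of edges with exactly one endpoint in `W`. -/
noncomputable def boundaryCard (G : SimpleGraph V) [G.LocallyFinite] (W : Finset V) : ℕ :=
  ∑ w ∈ W, ((G.neighborFinset w).filter (fun z => z ∉ W)).card

/-- `deg(W)`: the sum of degrees of vertices in `W`. -/
noncomputable def degSum (G : SimpleGraph V) [G.LocallyFinite] (W : Finset V) : ℕ :=
  ∑ w ∈ W, G.degree w

/-- The isoperimetric profile `Φ(n)`. -/
noncomputable def isoProfile (G : SimpleGraph V) [G.LocallyFinite] (n : ℕ) : ℝ :=
  ⨅ W : {W : Finset V // W.Nonempty ∧ degSum G W ≤ n},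
    (boundaryCard G W.1 : ℝ) / (degSum G W.1 : ℝ)

/-- `q_m(u,v)`: probability that the lazy walk started at `u` first visits `v` at time `m`. -/
noncomputable def firstHit (G : SimpleGraph V) [G.LocallyFinite] (m : ℕ) (u v : V) : ℝ :=
  walkProb G m u {p | p (Fin.last m) = v ∧ ∀ i : Fin (m+1), i ≠ Fin.last m → p i ≠ v}

/-- The massive Green function `G_t(u,v)`. -/
noncomputable def greenT (G : SimpleGraph V) [G.LocallyFinite] (t : ℝ) (u v : V) : ℝ :=
  ∑' m : ℕ, (t/(t+1))^m * firstHit G m u v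


set_option linter.unusedSectionVars false

section helpers
variable [Fintype V] (G : SimpleGraph V) [G.LocallyFinite]

theorem step_eq (x y : V) : step G x y =
    (if x = y then (1/2 : ℝ) else 0) + (if G.Adj x y then 1 / (2 * (G.degree x : ℝ)) else 0) := by
  unfold step
  by_cases h : x = y
  · subst h; simp
  · simp [h]

theorem step_nonneg (x y : V) : 0 ≤ step G x y := by
  rw [step_eq]
  have : (0:ℝ) ≤ 1 / (2 * (G.degree x : ℝ)) := by positivity
  split_ifs <;> linarith

theorem sum_adj (x : V) (c : ℝ) : ∑ y, (if G.Adj x y then c else 0) = G.degree x * c := by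
  rw [← Finset.sum_filter, Finset.sum_const, nsmul_eq_mul]
  congr 2
  rw [← SimpleGraph.card_neighborFinset_eq_degree]
  congr 1
  ext y
  simp

theorem sum_step (hd : ∀ x, 0 < G.degree x) (x : V) : ∑ y, step G x y = 1 := by
  simp_rw [step_eq]
  rw [Finset.sum_add_distrib, sum_adj]
  have := hd x
  have h : (0:ℝ) < G.degree x := by exact_mod_cast this
  simp
  field_simp
  norm_num

theorem P_zero (x y : V) : Pmat G 0 x y = if x = y then 1 else 0 := by simp [Pmat]

theorem P_succ (m : ℕ) (x y : V) : Pmat G (m+1) x y = ∑ z, Pmat G m x z * step G z y := by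
  simp [Pmat, tsum_fintype]

theorem P_succ' (m : ℕ) : ∀ (x y : V), Pmat G (m+1) x y = ∑ z, step G x z * Pmat G m z y := by
  induction m with
  | zero => intro x y; rw [P_succ]; simp [P_zero]
  | succ m ih =>
    intro x y
    rw [P_succ]
    have e1 : ∀ z, step G x z * Pmat G (m+1) z y
        = ∑ w, step G x z * (Pmat G m z w * step G w y) := by
      intro z; rw [P_succ, Finset.mul_sum]
    have e2 : ∀ w, Pmat G (m+1) x w * step G w y
        = ∑ z, step G x z * (Pmat G m z w * step G w y) := by
      intro w; rw [ih, Finset.sum_mul]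
      exact Finset.sum_congr rfl fun z _ => mul_assoc _ _ _
    rw [Finset.sum_congr rfl fun z _ => e1 z, Finset.sum_congr rfl fun z _ => e2 z]
    exact Finset.sum_comm

theorem P_one (x y : V) : Pmat G 1 x y = step G x y := by
  rw [P_succ]; simp [P_zero]

theorem P_nonneg (m : ℕ) : ∀ (x y : V), 0 ≤ Pmat G m x y := by
  induction m with
  | zero => intro x y; rw [P_zero]; split_ifs <;> norm_num
  | succ m ih =>
    intro x y
    rw [P_succ]
    exact Finset.sum_nonneg fun z _ => mul_nonneg (ih _ _) (step_nonneg G _ _)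

theorem sum_P (hd : ∀ x, 0 < G.degree x) (m : ℕ) : ∀ x, ∑ y, Pmat G m x y = 1 := by
  induction m with
  | zero => intro x; simp [P_zero]
  | succ m ih =>
    intro x
    simp_rw [P_succ]
    rw [Finset.sum_comm]
    simp_rw [← Finset.mul_sum, sum_step G hd, mul_one, ih]

theorem P_le_one (hd : ∀ x, 0 < G.degree x) (m : ℕ) (x y : V) : Pmat G m x y ≤ 1 := by
  rw [← sum_P G hd m x]
  exact Finset.single_le_sum (f := fun y => Pmat G m x y) (fun z _ => P_nonneg G m x z)
    (Finset.mem_univ y)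

theorem step_rev (hd : ∀ x, 0 < G.degree x) (x y : V) :
    G.degree x * step G x y = G.degree y * step G y x := by
  rw [step_eq, step_eq]
  by_cases h : x = y
  · subst h; rfl
  · have h' : ¬ y = x := fun e => h e.symm
    have hx : (G.degree x : ℝ) ≠ 0 := by exact_mod_cast (hd x).ne'
    have hy : (G.degree y : ℝ) ≠ 0 := by exact_mod_cast (hd y).ne'
    simp only [h, h', if_false, G.adj_comm y x]
    split_ifs
    · field_simp; ring
    · simp

theorem P_rev (hd : ∀ x, 0 < G.degree x) (m : ℕ) : ∀ (x y : V),
    G.degree x * Pmat G m x y = G.degree y * Pmat G m y x := by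
  induction m with
  | zero =>
    intro x y
    rw [P_zero, P_zero]
    by_cases h : x = y
    · subst h; rfl
    · simp [h, Ne.symm h]
  | succ m ih =>
    intro x y
    rw [P_succ, P_succ', Finset.mul_sum, Finset.mul_sum]
    refine Finset.sum_congr rfl fun z _ => ?_
    rw [← mul_assoc, ih, ← mul_assoc, ← step_rev G hd z y]
    ring

theorem P_pos_dist (hc : G.Connected) (m : ℕ) : ∀ (x y : V), 0 < Pmat G m x y → G.dist x y ≤ m := by
  induction m with
  | zero =>
    intro x y h
    rw [P_zero] at h
    by_cases h' : x = y
    · subst h'; simp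
    · simp [h'] at h
  | succ m ih =>
    intro x y h
    rw [P_succ] at h
    obtain ⟨z, _, hz⟩ : ∃ z ∈ Finset.univ, 0 < Pmat G m x z * step G z y := by
      by_contra hcon
      push Not at hcon
      exact absurd h (not_lt.mpr (Finset.sum_nonpos hcon))
    have h1 : 0 < Pmat G m x z := by
      rcases (P_nonneg G m x z).lt_or_eq with h | h
      · exact h
      · rw [← h] at hz; simp at hz
    have h2 : G.dist z y ≤ 1 := by
      by_cases e : z = y
      · subst e; simp
      · by_cases a : G.Adj z y
        · rw [SimpleGraph.dist_eq_one_iff_adj.mpr a]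
        · rw [step_eq] at hz; simp [e, a] at hz
    have := ih _ _ h1
    have := hc.dist_triangle (u := x) (v := z) (w := y)
    omega

theorem path_sum (m : ℕ) (x : V) : ∀ f : V → ℝ,
    ∑ p : Fin (m+1) → V, pathProb G m x p * f (p (Fin.last m)) = ∑ z, Pmat G m x z * f z := by
  induction m with
  | zero =>
    intro f
    rw [← (Equiv.funUnique (Fin 1) V).symm.sum_comp]
    refine Finset.sum_congr rfl fun z _ => ?_
    simp [pathProb, P_zero, Equiv.funUnique, eq_comm]
  | succ m ih =>
    intro f
    rw [← (Fin.snocEquiv (fun _ : Fin (m+2) => V)).sum_comp, Fintype.sum_prod_type_right]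
    have key : ∀ (q : Fin (m+1) → V) (y : V),
        pathProb G (m+1) x (Fin.snocEquiv (fun _ : Fin (m+2) => V) (y, q)) =
        pathProb G m x q * step G (q (Fin.last m)) y := by
      intro q y
      unfold pathProb
      rw [Fin.prod_univ_castSucc]
      have h0 : (Fin.snoc (α := fun _ : Fin (m+2) => V) q y) 0 = q 0 := by
        exact Fin.snoc_castSucc (α := fun _ : Fin (m+2) => V) y q 0
      have h1 : ∀ i : Fin (m+1), (Fin.snoc (α := fun _ : Fin (m+2) => V) q y) i.castSucc = q i :=
        fun i => Fin.snoc_castSucc (α := fun _ : Fin (m+2) => V) y q i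
      have h2 : (Fin.snoc (α := fun _ : Fin (m+2) => V) q y) (Fin.last (m+1)) = y :=
        Fin.snoc_last (α := fun _ : Fin (m+2) => V) y q
      simp only [Fin.snocEquiv_apply, h0, h1, Fin.succ_castSucc, Fin.succ_last, h2]
      ring
    have h3 : ∀ (q : Fin (m+1) → V) (y : V),
        Fin.snocEquiv (fun _ : Fin (m+2) => V) (y, q) (Fin.last (m+1)) = y := by
      intro q y
      simp [Fin.snocEquiv]
    simp_rw [key, h3]
    have := ih (fun w => ∑ y, step G w y * f y)
    simp_rw [P_succ, Finset.sum_mul]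
    rw [Finset.sum_comm (s := Finset.univ (α := V))]
    simp_rw [Finset.mul_sum] at this
    simp_rw [mul_assoc]
    exact this

theorem expDist_eq (m : ℕ) (x : V) : expDist G m x = ∑ z, Pmat G m x z * (G.dist x z : ℝ) := by
  unfold expDist walkExp
  rw [tsum_fintype, ← path_sum G m x (fun z => (G.dist x z : ℝ))]
  refine Finset.sum_congr rfl fun p _ => ?_
  by_cases h : p 0 = x
  · simp only [h]
  · simp [pathProb, h]

theorem expDist_le (n m : ℕ) (hm : m ≤ n) (x : V) : expDist G m x ≤ Dstar G n := by
  unfold Dstar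
  refine le_trans ?_ (le_ciSup (Set.finite_range _).bddAbove x)
  exact le_ciSup (f := fun m : Fin (n+1) => expDist G m.1 x)
    (Set.finite_range _).bddAbove ⟨m, by omega⟩

theorem entropy_le (n m : ℕ) (hm : m ≤ n) (x : V) : entropy G m x ≤ Hstar G n := by
  unfold Hstar
  refine le_trans ?_ (le_ciSup (Set.finite_range _).bddAbove x)
  exact le_ciSup (f := fun m : Fin (n+1) => entropy G m.1 x)
    (Set.finite_range _).bddAbove ⟨m, by omega⟩

theorem TV_ge (n : ℕ) (x y : V) (h : G.Adj x y) :
    ∑ z, |Pmat G n x z - Pmat G n y z| ≤ 2 * TV G n := by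
  have := le_ciSup (f := fun e : {p : V × V // G.Adj p.1 p.2} =>
    (1/2) * ∑' z, |Pmat G n e.val.1 z - Pmat G n e.val.2 z|)
    (Set.finite_range _).bddAbove ⟨(x, y), h⟩
  simp only [tsum_fintype] at this
  unfold TV
  simp only [tsum_fintype]
  linarith

theorem TV_le_one (hd : ∀ x, 0 < G.degree x) (n : ℕ) : TV G n ≤ 1 := by
  unfold TV
  refine Real.iSup_le (fun e => ?_) zero_le_one
  rw [tsum_fintype]
  have : ∑ z, |Pmat G n e.val.1 z - Pmat G n e.val.2 z| ≤
      ∑ z, (Pmat G n e.val.1 z + Pmat G n e.val.2 z) := by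
    refine Finset.sum_le_sum fun z _ => ?_
    have h1 := P_nonneg G n e.val.1 z
    have h2 := P_nonneg G n e.val.2 z
    rw [abs_le]; constructor <;> linarith
  rw [Finset.sum_add_distrib, sum_P G hd, sum_P G hd] at this
  linarith

theorem exists_adj (n : ℕ) (h : 0 < TV G n) : ∃ x y, G.Adj x y := by
  by_contra hcon
  push Not at hcon
  unfold TV at h
  have : IsEmpty {p : V × V // G.Adj p.1 p.2} := ⟨fun e => hcon _ _ e.2⟩
  rw [Real.iSup_of_isEmpty] at h
  exact lt_irrefl _ h

theorem Dstar_ge (hd : ∀ x, 0 < G.degree x) (hc : G.Connected) (n : ℕ) (hn : 1 ≤ n) (x : V) :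
    1/2 ≤ Dstar G n := by
  refine le_trans ?_ (expDist_le G n 1 hn x)
  rw [expDist_eq]
  have h1 : ∑ z, step G x z - ∑ z, (if x = z then (1/2:ℝ) else 0) ≤
      ∑ z, Pmat G 1 x z * (G.dist x z : ℝ) := by
    rw [← Finset.sum_sub_distrib]
    refine Finset.sum_le_sum fun z _ => ?_
    rw [P_one]
    by_cases e : x = z
    · subst e; simp [step]
    · have : 0 < G.dist x z := hc.pos_dist_of_ne e
      have h : (1:ℝ) ≤ G.dist x z := by exact_mod_cast this
      simp only [e, if_false, sub_zero]
      exact le_mul_of_one_le_right (step_nonneg G x z) h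
  rw [sum_step G hd] at h1
  simp at h1
  linarith

theorem negMul_nonneg (hd : ∀ x, 0 < G.degree x) (m : ℕ) (x y : V) :
    0 ≤ Real.negMulLog (Pmat G m x y) :=
  Real.negMulLog_nonneg (P_nonneg G m x y) (P_le_one G hd m x y)

theorem Hstar_ge (hd : ∀ x, 0 < G.degree x) (n : ℕ) (hn : 1 ≤ n) (x : V) :
    Real.log 2 / 2 ≤ Hstar G n := by
  refine le_trans ?_ (entropy_le G n 1 hn x)
  unfold entropy
  rw [tsum_fintype]
  have := Finset.single_le_sum (f := fun y => Real.negMulLog (Pmat G 1 x y))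
    (fun y _ => negMul_nonneg G hd 1 x y) (Finset.mem_univ x)
  refine le_trans (le_of_eq ?_) this
  simp only [P_one, step, if_true, Real.negMulLog]
  rw [one_div, Real.log_inv]; ring

end helpers

section hitting
variable [Fintype V] (G : SimpleGraph V) [G.LocallyFinite]

/-- Probability of hitting `B` within `m` steps. -/
noncomputable def hit (B : V → Prop) : ℕ → V → ℝ
  | 0, y => if B y then 1 else 0
  | (m+1), y => if B y then 1 else ∑ z, step G y z * hit B m z

/-- Probability of being in `B` at time `m`. -/
noncomputable def inP (B : V → Prop) (m : ℕ) (y : V) : ℝ :=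
  ∑ z, Pmat G m y z * (if B z then 1 else 0)

theorem hit_of_mem (B : V → Prop) (m : ℕ) (y : V) (h : B y) : hit G B m y = 1 := by
  cases m <;> simp [hit, h]

theorem hit_succ_of_not (B : V → Prop) (m : ℕ) (y : V) (h : ¬ B y) :
    hit G B (m+1) y = ∑ z, step G y z * hit G B m z := by
  simp [hit, h]

theorem hit_zero_of_not (B : V → Prop) (y : V) (h : ¬ B y) : hit G B 0 y = 0 := by
  simp [hit, h]

theorem hit_nonneg (B : V → Prop) (m : ℕ) : ∀ y, 0 ≤ hit G B m y := by
  induction m with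
  | zero => intro y; unfold hit; split_ifs <;> norm_num
  | succ m ih =>
    intro y
    by_cases h : B y
    · rw [hit_of_mem G B _ y h]; norm_num
    · rw [hit_succ_of_not G B m y h]
      exact Finset.sum_nonneg fun z _ => mul_nonneg (step_nonneg G _ _) (ih z)

theorem hit_le_one (hd : ∀ x, 0 < G.degree x) (B : V → Prop) (m : ℕ) : ∀ y, hit G B m y ≤ 1 := by
  induction m with
  | zero => intro y; unfold hit; split_ifs <;> norm_num
  | succ m ih =>
    intro y
    by_cases h : B y
    · rw [hit_of_mem G B _ y h]
    · rw [hit_succ_of_not G B m y h, ← sum_step G hd y]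
      exact Finset.sum_le_sum fun z _ => mul_le_of_le_one_right (step_nonneg G _ _) (ih z)

theorem hit_mono (hd : ∀ x, 0 < G.degree x) (A B : V → Prop) (hAB : ∀ y, A y → B y) (m : ℕ) :
    ∀ y, hit G A m y ≤ hit G B m y := by
  induction m with
  | zero =>
    intro y
    by_cases h : A y
    · rw [hit_of_mem G A _ y h, hit_of_mem G B _ y (hAB y h)]
    · rw [hit_zero_of_not G A y h]; exact hit_nonneg G B 0 y
  | succ m ih =>
    intro y
    by_cases h : B y
    · rw [hit_of_mem G B _ y h]; exact hit_le_one G hd A _ y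
    · have h' : ¬ A y := fun a => h (hAB y a)
      rw [hit_succ_of_not G B m y h, hit_succ_of_not G A m y h']
      exact Finset.sum_le_sum fun z _ => mul_le_mul_of_nonneg_left (ih z) (step_nonneg G _ _)

theorem inP_zero (B : V → Prop) (y : V) : inP G B 0 y = if B y then 1 else 0 := by
  unfold inP
  rw [Finset.sum_eq_single y]
  · simp [P_zero]
  · intro z _ hz
    simp [P_zero, Ne.symm hz]
  · simp

theorem inP_succ (B : V → Prop) (m : ℕ) (y : V) :
    inP G B (m+1) y = ∑ z, step G y z * inP G B m z := by
  unfold inP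
  simp_rw [Finset.mul_sum, P_succ', Finset.sum_mul]
  rw [Finset.sum_comm]
  refine Finset.sum_congr rfl fun z _ => Finset.sum_congr rfl fun w _ => by ring

theorem inP_nonneg (B : V → Prop) (m : ℕ) (y : V) : 0 ≤ inP G B m y := by
  refine Finset.sum_nonneg fun z _ => mul_nonneg (P_nonneg G _ _ _) ?_
  split_ifs <;> norm_num

theorem inP_le_one (hd : ∀ x, 0 < G.degree x) (B : V → Prop) (m : ℕ) (y : V) :
    inP G B m y ≤ 1 := by
  rw [← sum_P G hd m y]
  refine Finset.sum_le_sum fun z _ => mul_le_of_le_one_right (P_nonneg G _ _ _) ?_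
  split_ifs <;> norm_num

theorem inP_le_hit (hd : ∀ x, 0 < G.degree x) (B : V → Prop) (m : ℕ) :
    ∀ y, inP G B m y ≤ hit G B m y := by
  induction m with
  | zero => intro y; rw [inP_zero]; rfl
  | succ m ih =>
    intro y
    by_cases h : B y
    · rw [hit_of_mem G B _ y h]; exact inP_le_one G hd B _ y
    · rw [inP_succ, hit_succ_of_not G B m y h]
      exact Finset.sum_le_sum fun z _ => mul_le_mul_of_nonneg_left (ih z) (step_nonneg G _ _)

theorem one_le_inP_add (hd : ∀ x, 0 < G.degree x) (A B : V → Prop) (hAB : ∀ z, A z ∨ B z)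
    (m : ℕ) (y : V) : 1 ≤ inP G A m y + inP G B m y := by
  rw [← sum_P G hd m y]
  unfold inP
  rw [← Finset.sum_add_distrib]
  refine Finset.sum_le_sum fun z _ => ?_
  have := P_nonneg G m y z
  rcases hAB z with h | h
  · simp only [h, if_true, mul_one]
    split_ifs <;> linarith
  · simp only [h, if_true, mul_one]
    split_ifs <;> linarith

variable (G' : SimpleGraph V)

theorem step_dist (hle : G ≤ G') (x y : V) (h : step G x y ≠ 0) : G'.dist x y ≤ 1 := by
  by_cases e : x = y
  · subst e; simp
  · by_cases a : G.Adj x y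
    · rw [SimpleGraph.dist_eq_one_iff_adj.mpr (hle a)]
    · rw [step_eq] at h; simp [e, a] at h

theorem maximal (hd : ∀ x, 0 < G.degree x) (hc : G'.Connected) (n b : ℕ)
    (hb : ∀ m ≤ n, ∀ y, inP G (fun z => b ≤ G'.dist y z) m y ≤ 1/4) (x : V) :
    ∀ m ≤ n, ∀ y, 3/4 * hit G (fun z => 2*b ≤ G'.dist x z) m y ≤
      inP G (fun z => b ≤ G'.dist x z) m y := by
  have hin : ∀ m ≤ n, ∀ y, 2*b ≤ G'.dist x y → 3/4 * hit G (fun z => 2*b ≤ G'.dist x z) m y ≤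
      inP G (fun z => b ≤ G'.dist x z) m y := by
    intro m hm y hy
    rw [hit_of_mem G _ m y hy]
    have h1 := hb m hm y
    have h2 := one_le_inP_add G hd (fun z => b ≤ G'.dist x z) (fun z => b ≤ G'.dist y z) (by
      intro z
      have := hc.dist_triangle (u := x) (v := z) (w := y)
      rw [SimpleGraph.dist_comm (u := z) (v := y)] at this
      omega) m y
    linarith
  intro m
  induction m with
  | zero =>
    intro hm y
    by_cases hy : 2*b ≤ G'.dist x y
    · exact hin 0 hm y hy
    · rw [hit_zero_of_not G _ y hy, mul_zero]; exact inP_nonneg G _ _ _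
  | succ m ih =>
    intro hm y
    by_cases hy : 2*b ≤ G'.dist x y
    · exact hin _ hm y hy
    · rw [hit_succ_of_not G _ m y hy, inP_succ, Finset.mul_sum]
      refine Finset.sum_le_sum fun z _ => ?_
      have := mul_le_mul_of_nonneg_left (ih (by omega) z) (step_nonneg G y z)
      linarith

theorem iterate_hit (hd : ∀ x, 0 < G.degree x) (hle : G ≤ G') (hc : G'.Connected) (n b : ℕ)
    (hb : ∀ m ≤ n, ∀ y, inP G (fun z => b ≤ G'.dist y z) m y ≤ 1/4) (x : V) (A : ℕ) :
    ∀ m ≤ n, ∀ y, G'.dist x y ≤ A → hit G (fun z => A + 2*b ≤ G'.dist x z) m y ≤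
      1/3 * hit G (fun z => A ≤ G'.dist x z) m y := by
  have hin : ∀ m ≤ n, ∀ y, G'.dist x y = A → hit G (fun z => A + 2*b ≤ G'.dist x z) m y ≤
      1/3 * hit G (fun z => A ≤ G'.dist x z) m y := by
    intro m hm y hy
    rw [hit_of_mem G (fun z => A ≤ G'.dist x z) m y hy.ge]
    have h1 := hit_mono G hd (fun z => A + 2*b ≤ G'.dist x z) (fun z => 2*b ≤ G'.dist y z) (by
      intro z hz
      have := hc.dist_triangle (u := x) (v := y) (w := z)
      omega) m y
    have h2 := maximal G G' hd hc n b hb y m hm y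
    have h3 := hb m hm y
    linarith
  intro m
  induction m with
  | zero =>
    intro hm y hy
    rcases hy.eq_or_lt with h | h
    · exact hin 0 hm y h
    · rw [hit_zero_of_not G _ y (by omega), hit_zero_of_not G _ y (by omega)]; norm_num
  | succ m ih =>
    intro hm y hy
    rcases hy.eq_or_lt with h | h
    · exact hin _ hm y h
    · rw [hit_succ_of_not G _ m y (by omega), hit_succ_of_not G _ m y (by omega), Finset.mul_sum]
      refine Finset.sum_le_sum fun z _ => ?_
      by_cases hs : step G y z = 0
      · rw [hs]; simp
      · have h1 := step_dist G G' hle y z hs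
        have h2 := hc.dist_triangle (u := x) (v := y) (w := z)
        have := mul_le_mul_of_nonneg_left (ih (by omega) z (by omega)) (step_nonneg G y z)
        linarith

theorem tail (hd : ∀ x, 0 < G.degree x) (hle : G ≤ G') (hc : G'.Connected) (n b : ℕ)
    (hb : ∀ m ≤ n, ∀ y, inP G (fun z => b ≤ G'.dist y z) m y ≤ 1/4) (x : V) (k : ℕ) :
    inP G (fun z => k * (2*b) ≤ G'.dist x z) n x ≤ (1/3)^k := by
  refine (inP_le_hit G hd _ n x).trans ?_
  induction k with
  | zero => simpa using hit_le_one G hd _ n x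
  | succ k ih =>
    have := iterate_hit G G' hd hle hc n b hb x (k * (2*b)) n le_rfl x (by simp)
    rw [pow_succ]
    have e : (k+1) * (2*b) = k * (2*b) + 2*b := by ring
    rw [e]
    linarith

theorem ball_card (hc : G'.Connected) (K : ℝ) (hK : 0 ≤ K)
    (hdeg : ∀ z, ((Finset.univ.filter (fun x => x = z ∨ G'.Adj z x)).card : ℝ) ≤ K) (z : V) (r : ℕ) :
    ((Finset.univ.filter (fun x => G'.dist z x ≤ r)).card : ℝ) ≤ K ^ r := by
  induction r with
  | zero =>
    have : (Finset.univ.filter (fun x => G'.dist z x ≤ 0)) = {z} := by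
      ext x
      simp [hc.dist_eq_zero_iff, eq_comm]
    rw [this]; simp
  | succ r ih =>
    have hsub : (Finset.univ.filter (fun x => G'.dist z x ≤ r+1)) ⊆
        (Finset.univ.filter (fun x => G'.dist z x ≤ r)).biUnion
          (fun y => Finset.univ.filter (fun x => x = y ∨ G'.Adj y x)) := by
      intro x hx
      simp only [Finset.mem_filter, Finset.mem_univ, true_and, Finset.mem_biUnion] at hx ⊢
      rcases Nat.lt_or_ge r (G'.dist z x) with h | h
      · obtain ⟨p, hp⟩ := hc.exists_walk_length_eq_dist x z
        cases p with
        | nil => simp at h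
        | cons ha q =>
          rename_i y
          refine ⟨y, ?_, Or.inr ha.symm⟩
          rw [SimpleGraph.dist_comm (u := x)] at hp
          simp only [SimpleGraph.Walk.length_cons] at hp
          have := SimpleGraph.dist_le q
          rw [SimpleGraph.dist_comm]
          omega
      · exact ⟨x, h, Or.inl rfl⟩
    have h1 := (Finset.card_le_card hsub).trans Finset.card_biUnion_le
    have h2 : ((Finset.univ.filter (fun x => G'.dist z x ≤ r+1)).card : ℝ) ≤
      ∑ y ∈ (Finset.univ.filter (fun x => G'.dist z x ≤ r)),
        ((Finset.univ.filter (fun x => x = y ∨ G'.Adj y x)).card : ℝ) := by exact_mod_cast h1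
    refine h2.trans ((Finset.sum_le_sum fun y _ => hdeg y).trans ?_)
    rw [Finset.sum_const, nsmul_eq_mul, pow_succ]
    exact mul_le_mul_of_nonneg_right ih hK

end hitting

section greedy
variable [Fintype V] (G : SimpleGraph V) [G.LocallyFinite]

/-- Number of ordered adjacent pairs between two sets. -/
noncomputable def eAB (A B : Finset V) : ℝ :=
  ∑ x ∈ A, ∑ y ∈ B, (if G.Adj x y then (1:ℝ) else 0)

theorem eAB_comm (A B : Finset V) : eAB G A B = eAB G B A := by
  unfold eAB
  rw [Finset.sum_comm]
  simp_rw [G.adj_comm]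

theorem eAB_le_deg (A B : Finset V) : eAB G A B ≤ degSum G A := by
  unfold eAB degSum
  push_cast
  refine Finset.sum_le_sum fun x _ => ?_
  have h := sum_adj G x 1
  rw [mul_one] at h
  rw [← h]
  refine Finset.sum_le_sum_of_subset_of_nonneg (Finset.subset_univ _) fun y _ _ => ?_
  split_ifs <;> norm_num

theorem boundary_eq (W : Finset V) : (boundaryCard G W : ℝ) = eAB G W (Finset.univ \ W) := by
  unfold boundaryCard eAB
  push_cast
  refine Finset.sum_congr rfl fun x _ => ?_
  rw [← Finset.sum_filter, Finset.sum_const, nsmul_eq_mul, mul_one]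
  congr 2
  ext y
  simp [and_comm]

theorem int_ind (a : ℝ) (h0 : 0 ≤ a) (h1 : a ≤ 1) :
    IntervalIntegrable (fun t : ℝ => if t < a then (1:ℝ) else 0) MeasureTheory.volume 0 1 ∧
    ∫ t in (0:ℝ)..1, (if t < a then (1:ℝ) else 0) = a := by
  have hm : Antitone (fun t : ℝ => if t < a then (1:ℝ) else 0) := by
    intro s t hst
    dsimp only
    split_ifs <;> linarith
  refine ⟨hm.intervalIntegrable, ?_⟩
  rw [← intervalIntegral.integral_add_adjacent_intervals (b := a)
    hm.intervalIntegrable hm.intervalIntegrable]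
  have e1 : ∫ t in (0:ℝ)..a, (if t < a then (1:ℝ) else 0) = ∫ t in (0:ℝ)..a, (1:ℝ) := by
    rw [intervalIntegral.integral_of_le h0, intervalIntegral.integral_of_le h0,
      MeasureTheory.integral_Ioc_eq_integral_Ioo, MeasureTheory.integral_Ioc_eq_integral_Ioo]
    refine MeasureTheory.setIntegral_congr_fun measurableSet_Ioo fun t ht => ?_
    simp [ht.2]
  have e2 : ∫ t in a..(1:ℝ), (if t < a then (1:ℝ) else 0) = ∫ t in a..(1:ℝ), (0:ℝ) := by
    refine intervalIntegral.integral_congr fun t ht => ?_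
    rw [Set.uIcc_of_le h1] at ht
    simp [not_lt.mpr ht.1]
  rw [e1, e2]
  simp

/-- Coarea inequality. -/
theorem coarea (U : Finset V) (f : V → ℝ) (h0 : ∀ x, 0 ≤ f x) (h1 : ∀ x, f x ≤ 1) (c : ℝ)
    (h : ∀ t : ℝ, 0 ≤ t → c * degSum G (U.filter (fun x => t < f x)) ≤
      eAB G (U.filter (fun x => t < f x)) (U \ U.filter (fun x => t < f x))) :
    c * ∑ x ∈ U, G.degree x * f x ≤
      ∑ x ∈ U, ∑ y ∈ U, (if G.Adj x y then |f x - f y| else 0) := by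
  have hL : ∀ t : ℝ, (c * degSum G (U.filter (fun x => t < f x)) : ℝ) =
      c * ∑ x ∈ U, G.degree x * (if t < f x then (1:ℝ) else 0) := by
    intro t
    unfold degSum
    push_cast
    rw [Finset.sum_filter]
    simp
  have hR : ∀ t : ℝ, eAB G (U.filter (fun x => t < f x)) (U \ U.filter (fun x => t < f x)) =
      ∑ x ∈ U, ∑ y ∈ U, (if G.Adj x y then (1:ℝ) else 0) *
        ((if t < f x then (1:ℝ) else 0) - (if t < min (f x) (f y) then (1:ℝ) else 0)) := by
    intro t
    unfold eAB
    rw [Finset.sum_filter]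
    refine Finset.sum_congr rfl fun x _ => ?_
    by_cases hx : t < f x
    · have : U \ U.filter (fun x => t < f x) = U.filter (fun y => ¬ t < f y) := by
        ext y; simp only [Finset.mem_sdiff, Finset.mem_filter]; tauto
      rw [this, Finset.sum_filter]
      simp only [hx, if_true, lt_min_iff, true_and]
      refine Finset.sum_congr rfl fun y _ => ?_
      split_ifs <;> norm_num
    · simp [hx]
  have iL : ∀ x, IntervalIntegrable (fun t : ℝ => if t < f x then (1:ℝ) else 0)
      MeasureTheory.volume 0 1 := fun x => (int_ind _ (h0 x) (h1 x)).1
  have iM : ∀ x y, IntervalIntegrable (fun t : ℝ => if t < min (f x) (f y) then (1:ℝ) else 0)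
      MeasureTheory.volume 0 1 := fun x y =>
        (int_ind _ (le_min (h0 x) (h0 y)) (min_le_of_left_le (h1 x))).1
  have i1 : IntervalIntegrable (fun t : ℝ => c * ∑ x ∈ U, G.degree x *
      (if t < f x then (1:ℝ) else 0)) MeasureTheory.volume 0 1 := by
    refine IntervalIntegrable.const_mul ?_ _
    have := IntervalIntegrable.sum U (μ := MeasureTheory.volume) (a := (0:ℝ)) (b := 1)
      (f := fun x => fun t : ℝ => (G.degree x : ℝ) * (if t < f x then (1:ℝ) else 0))
      (fun x _ => (iL x).const_mul _)
    simpa [Finset.sum_fn] using this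
  have i2' : ∀ x, IntervalIntegrable (fun t : ℝ => ∑ y ∈ U, (if G.Adj x y then (1:ℝ) else 0) *
        ((if t < f x then (1:ℝ) else 0) - (if t < min (f x) (f y) then (1:ℝ) else 0)))
        MeasureTheory.volume 0 1 := by
    intro x
    have := IntervalIntegrable.sum U (μ := MeasureTheory.volume) (a := (0:ℝ)) (b := 1)
      (f := fun y => fun t : ℝ => (if G.Adj x y then (1:ℝ) else 0) *
        ((if t < f x then (1:ℝ) else 0) - (if t < min (f x) (f y) then (1:ℝ) else 0)))
      (fun y _ => ((iL x).sub (iM x y)).const_mul _)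
    rw [Finset.sum_fn] at this
    exact this
  have i2 : IntervalIntegrable (fun t : ℝ => ∑ x ∈ U, ∑ y ∈ U, (if G.Adj x y then (1:ℝ) else 0) *
        ((if t < f x then (1:ℝ) else 0) - (if t < min (f x) (f y) then (1:ℝ) else 0)))
        MeasureTheory.volume 0 1 := by
    have := IntervalIntegrable.sum U (μ := MeasureTheory.volume) (a := (0:ℝ)) (b := 1)
      (fun x _ => i2' x)
    rw [Finset.sum_fn] at this
    exact this
  have hint := intervalIntegral.integral_mono_on (μ := MeasureTheory.volume) zero_le_one i1 i2
    (fun t ht => by rw [← hL, ← hR]; exact h t ht.1)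
  rw [intervalIntegral.integral_const_mul, intervalIntegral.integral_finsetSum
    (fun x _ => (iL x).const_mul _), intervalIntegral.integral_finsetSum (fun x _ => i2' x)] at hint
  have e1 : ∀ x, ∫ t in (0:ℝ)..1, (G.degree x : ℝ) * (if t < f x then (1:ℝ) else 0)
      = G.degree x * f x := by
    intro x
    rw [intervalIntegral.integral_const_mul, (int_ind _ (h0 x) (h1 x)).2]
  have e2 : ∀ x, ∫ t in (0:ℝ)..1, (∑ y ∈ U, (if G.Adj x y then (1:ℝ) else 0) *
        ((if t < f x then (1:ℝ) else 0) - (if t < min (f x) (f y) then (1:ℝ) else 0)))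
      ≤ ∑ y ∈ U, (if G.Adj x y then |f x - f y| else 0) := by
    intro x
    rw [intervalIntegral.integral_finsetSum (fun y _ => ((iL x).sub (iM x y)).const_mul _)]
    refine Finset.sum_le_sum fun y _ => ?_
    rw [intervalIntegral.integral_const_mul, intervalIntegral.integral_sub (iL x) (iM x y),
      (int_ind _ (h0 x) (h1 x)).2, 
      (int_ind _ (le_min (h0 x) (h0 y)) (min_le_of_left_le (h1 x))).2]
    split_ifs
    · rw [one_mul]
      rcases le_total (f x) (f y) with hh | hh
      · rw [min_eq_left hh, sub_self]; exact abs_nonneg _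
      · rw [min_eq_right hh]; exact le_abs_self _
    · simp
  simp_rw [e1] at hint
  exact hint.trans (Finset.sum_le_sum fun x _ => e2 x)

/-- One greedy step. -/
theorem greedy_step (hd : ∀ x, 0 < G.degree x) (p : V → V → ℝ) (τ : ℝ) (hτ : 0 < τ)
    (h0 : ∀ x z, 0 ≤ p x z) (h1 : ∀ x z, p x z ≤ 1) (hs : ∀ x, 1/2 ≤ ∑ z, p x z)
    (hTV : ∀ x y, G.Adj x y → ∑ z, |p x z - p y z| ≤ 6 * τ) (U : Finset V) (hU : U.Nonempty) :
    ∃ W ⊆ U, W.Nonempty ∧ (∃ z, ∀ x ∈ W, 0 < p x z) ∧ eAB G W (U \ W) ≤ 13 * τ * degSum G W := by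
  by_contra hcon
  push Not at hcon
  have hpos : (0:ℝ) < degSum G U := by
    unfold degSum
    exact_mod_cast Finset.sum_pos (fun x _ => hd x) hU
  have key : ∀ z, 13 * τ * ∑ x ∈ U, G.degree x * p x z ≤
      ∑ x ∈ U, ∑ y ∈ U, (if G.Adj x y then |p x z - p y z| else 0) := by
    intro z
    refine coarea G U (fun x => p x z) (fun x => h0 x z) (fun x => h1 x z) _ fun t ht => ?_
    by_cases hne : (U.filter (fun x => t < p x z)).Nonempty
    · refine (hcon _ (Finset.filter_subset _ _) hne ⟨z, fun x hx => ?_⟩).le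
      exact lt_of_le_of_lt ht (Finset.mem_filter.mp hx).2
    · rw [Finset.not_nonempty_iff_eq_empty] at hne
      rw [hne]
      simp [degSum, eAB]
  have hsum := Finset.sum_le_sum (s := Finset.univ) fun z _ => key z
  rw [← Finset.mul_sum, Finset.sum_comm, Finset.sum_comm (s := Finset.univ)] at hsum
  have hA : (degSum G U : ℝ) * (1/2) ≤ ∑ x ∈ U, ∑ z, (G.degree x : ℝ) * p x z := by
    unfold degSum
    push_cast
    rw [Finset.sum_mul]
    refine Finset.sum_le_sum fun x _ => ?_
    rw [← Finset.mul_sum]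
    exact mul_le_mul_of_nonneg_left (hs x) (by positivity)
  have hB : ∑ x ∈ U, ∑ z, ∑ y ∈ U, (if G.Adj x y then |p x z - p y z| else 0)
      ≤ 6 * τ * degSum G U := by
    refine le_trans ?_ (mul_le_mul_of_nonneg_left (eAB_le_deg G U U) (by positivity))
    unfold eAB
    rw [Finset.mul_sum]
    refine Finset.sum_le_sum fun x _ => ?_
    rw [Finset.sum_comm, Finset.mul_sum]
    refine Finset.sum_le_sum fun y _ => ?_
    split_ifs with ha
    · rw [mul_one]; exact hTV x y ha
    · simp
  have h2 := mul_le_mul_of_nonneg_left hA (by positivity : (0:ℝ) ≤ 13 * τ)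
  have h3 : 0 < τ * degSum G U := by positivity
  linarith

theorem greedy (hd : ∀ x, 0 < G.degree x) (p : V → V → ℝ) (τ : ℝ) (hτ : 0 < τ)
    (h0 : ∀ x z, 0 ≤ p x z) (h1 : ∀ x z, p x z ≤ 1) (hs : ∀ x, 1/2 ≤ ∑ z, p x z)
    (hTV : ∀ x y, G.Adj x y → ∑ z, |p x z - p y z| ≤ 6 * τ) (N : ℕ) :
    ∀ U : Finset V, U.card ≤ N → ∃ P : Finset (Finset V),
      (∀ W ∈ P, W.Nonempty ∧ W ⊆ U ∧ ∃ z, ∀ x ∈ W, 0 < p x z) ∧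
      (∀ v ∈ U, ∃! W : Finset V, W ∈ P ∧ v ∈ W) ∧
      (∀ g : V → ℝ, ∑ W ∈ P, ∑ x ∈ W, g x = ∑ x ∈ U, g x) ∧
      ∑ W ∈ P, eAB G W (U \ W) ≤ 26 * τ * degSum G U := by
  induction N with
  | zero =>
    intro U hU
    have : U = ∅ := by simpa using hU
    subst this
    exact ⟨∅, by simp, by simp, by simp, by simp [degSum]⟩
  | succ N ih =>
    intro U hU
    rcases U.eq_empty_or_nonempty with he | hne
    · subst he
      exact ⟨∅, by simp, by simp, by simp, by simp [degSum]⟩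
    obtain ⟨W, hWU, hWne, hWz, hWe⟩ := greedy_step G hd p τ hτ h0 h1 hs hTV U hne
    have hcard : (U \ W).card ≤ N := by
      have := Finset.card_sdiff_add_card_eq_card hWU
      have := hWne.card_pos
      omega
    obtain ⟨P, hP1, hP2, hP3, hP4⟩ := ih (U \ W) hcard
    have hWP : W ∉ P := by
      intro hW
      obtain ⟨x, hx⟩ := hWne
      have := (hP1 W hW).2.1 hx
      simp [hx] at this
    have hdisj : ∀ W' ∈ P, ∀ x ∈ W', x ∉ W := fun W' hW' x hx =>
      (Finset.mem_sdiff.mp ((hP1 W' hW').2.1 hx)).2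
    have hsd : ∀ g : V → ℝ, ∑ x ∈ U, g x = ∑ x ∈ W, g x + ∑ x ∈ U \ W, g x := by
      intro g; rw [add_comm, Finset.sum_sdiff hWU]
    refine ⟨insert W P, ?_, ?_, ?_, ?_⟩
    · intro W' hW'
      rcases Finset.mem_insert.mp hW' with h | h
      · subst h; exact ⟨hWne, hWU, hWz⟩
      · obtain ⟨a, b, c⟩ := hP1 W' h
        exact ⟨a, b.trans Finset.sdiff_subset, c⟩
    · intro v hv
      by_cases hvW : v ∈ W
      · refine ⟨W, ⟨Finset.mem_insert_self _ _, hvW⟩, ?_⟩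
        rintro W' ⟨hW', hvW'⟩
        rcases Finset.mem_insert.mp hW' with h | h
        · exact h
        · exact absurd hvW (hdisj W' h v hvW')
      · obtain ⟨W', ⟨a, b⟩, c⟩ := hP2 v (Finset.mem_sdiff.mpr ⟨hv, hvW⟩)
        refine ⟨W', ⟨Finset.mem_insert_of_mem a, b⟩, ?_⟩
        rintro W'' ⟨hW', hvW'⟩
        rcases Finset.mem_insert.mp hW' with h | h
        · subst h; exact absurd hvW' hvW
        · exact c W'' ⟨h, hvW'⟩
    · intro g
      rw [Finset.sum_insert hWP, hP3, hsd]
    · rw [Finset.sum_insert hWP]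
      have e1 : ∑ W' ∈ P, eAB G W' (U \ W') =
          ∑ W' ∈ P, eAB G W' ((U \ W) \ W') + eAB G (U \ W) W := by
        have : eAB G (U \ W) W = ∑ W' ∈ P, eAB G W' W := by
          unfold eAB
          rw [hP3]
        rw [this, ← Finset.sum_add_distrib]
        refine Finset.sum_congr rfl fun W' hW' => ?_
        unfold eAB
        rw [← Finset.sum_add_distrib]
        refine Finset.sum_congr rfl fun x _ => ?_
        have hsub : W ⊆ U \ W' := fun y hy =>
          Finset.mem_sdiff.mpr ⟨hWU hy, fun hy' => hdisj W' hW' y hy' hy⟩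
        rw [← Finset.sum_sdiff hsub]
        congr 2
        ext y; simp only [Finset.mem_sdiff]; tauto
      have e2 : (degSum G U : ℝ) = degSum G W + degSum G (U \ W) := by
        unfold degSum; push_cast; exact hsd _
      rw [e1, e2, eAB_comm G (U \ W) W]
      linarith

end greedy

section final
variable [Fintype V] (G : SimpleGraph V) [G.LocallyFinite]

theorem markov_dist (hd : ∀ x, 0 < G.degree x) (hc : G.Connected) (n b : ℕ) (hn : 1 ≤ n)
    (hb : 4 * Dstar G n ≤ b) :
    ∀ m ≤ n, ∀ y, inP G (fun z => b ≤ G.dist y z) m y ≤ 1/4 := by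
  intro m hm y
  have hD := Dstar_ge G hd hc n hn y
  have h1 := expDist_le G n m hm y
  rw [expDist_eq] at h1
  have h2 : (b:ℝ) * inP G (fun z => b ≤ G.dist y z) m y ≤ ∑ z, Pmat G m y z * (G.dist y z : ℝ) := by
    unfold inP
    rw [Finset.mul_sum]
    refine Finset.sum_le_sum fun z _ => ?_
    have hP := P_nonneg G m y z
    split_ifs with h
    · have : (b:ℝ) ≤ G.dist y z := by exact_mod_cast h
      nlinarith
    · simp only [mul_zero]; positivity
  have h3 := inP_nonneg G (fun z => b ≤ G.dist y z) m y
  have h4 := mul_le_mul_of_nonneg_right hb h3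
  have h5 : Dstar G n * (4 * inP G (fun z => b ≤ G.dist y z) m y) ≤ Dstar G n * 1 := by linarith
  have := le_of_mul_le_mul_left h5 (by linarith)
  linarith

/-- The auxiliary graph joining vertices with a not too small transition probability. -/
def auxG (n : ℕ) (δ : ℝ) : SimpleGraph V :=
  SimpleGraph.fromRel (fun y z => ∃ m ≤ n, δ ≤ Pmat G m y z)

theorem le_auxG (M n : ℕ) (δ : ℝ) (hn : 1 ≤ n) (hd : ∀ x, 0 < G.degree x)
    (hM : ∀ v, G.degree v ≤ M) (hδ : δ ≤ 1 / (2 * M)) : G ≤ auxG G n δ := by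
  intro x y h
  unfold auxG
  rw [SimpleGraph.fromRel_adj]
  refine ⟨h.ne, Or.inl ⟨1, hn, ?_⟩⟩
  rw [P_one]
  unfold step
  rw [if_neg h.ne, if_pos h]
  refine hδ.trans ?_
  have h1 : (0:ℝ) < G.degree x := by exact_mod_cast hd x
  have h2 : (G.degree x : ℝ) ≤ M := by exact_mod_cast hM x
  apply one_div_le_one_div_of_le <;> linarith

theorem markov_ent (hd : ∀ x, 0 < G.degree x) (n : ℕ) (hn : 1 ≤ n) (L : ℝ)
    (hL : 4 * Hstar G n ≤ L) :
    ∀ m ≤ n, ∀ y, inP G (fun z => 2 ≤ (auxG G n (Real.exp (-L))).dist y z) m y ≤ 1/4 := by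
  intro m hm y
  have hH := Hstar_ge G hd n hn y
  have hlog : (0:ℝ) < Real.log 2 := Real.log_pos (by norm_num)
  have h1 := entropy_le G n m hm y
  unfold entropy at h1
  rw [tsum_fintype] at h1
  have h2 : L * inP G (fun z => 2 ≤ (auxG G n (Real.exp (-L))).dist y z) m y ≤
      ∑ z, Real.negMulLog (Pmat G m y z) := by
    unfold inP
    rw [Finset.mul_sum]
    refine Finset.sum_le_sum fun z _ => ?_
    have hP := P_nonneg G m y z
    split_ifs with h
    · have hlt : Pmat G m y z < Real.exp (-L) := by
        by_contra hcon
        push Not at hcon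
        by_cases e : y = z
        · subst e; simp at h
        · have ha : (auxG G n (Real.exp (-L))).Adj y z := by
            unfold auxG
            rw [SimpleGraph.fromRel_adj]
            exact ⟨e, Or.inl ⟨m, hm, hcon⟩⟩
          dsimp only at h
          rw [SimpleGraph.dist_eq_one_iff_adj.mpr ha] at h
          omega
      rcases hP.lt_or_eq with h0 | h0
      · have : Real.log (Pmat G m y z) ≤ -L := by
          rw [← Real.log_exp (-L)]
          exact Real.log_le_log h0 hlt.le
        unfold Real.negMulLog
        nlinarith
      · rw [← h0]; simp
    · simp only [mul_zero]; exact negMul_nonneg G hd m y z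
  have h3 := inP_nonneg G (fun z => 2 ≤ (auxG G n (Real.exp (-L))).dist y z) m y
  have h4 := mul_le_mul_of_nonneg_right hL h3
  have h5 : Hstar G n * (4 * inP G (fun z => 2 ≤ (auxG G n (Real.exp (-L))).dist y z) m y)
    ≤ Hstar G n * 1 := by linarith
  have := le_of_mul_le_mul_left h5 (by linarith)
  linarith

theorem aux_deg (M n : ℕ) (δ : ℝ) (hδ0 : 0 < δ) (hδ1 : δ ≤ 1) (hd : ∀ x, 0 < G.degree x)
    (hM : ∀ v, G.degree v ≤ M) (z : V) :
    ((Finset.univ.filter (fun x => x = z ∨ (auxG G n δ).Adj z x)).card : ℝ) ≤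
      (n+1) * M / δ := by
  have hM0 : (1:ℝ) ≤ M := by exact_mod_cast (hd z).trans_le (hM z)
  have key : ∀ x ∈ (Finset.univ.filter (fun x => x = z ∨ (auxG G n δ).Adj z x)),
      δ / M ≤ ∑ m ∈ Finset.range (n+1), Pmat G m z x := by
    intro x hx
    have hex : ∃ m ≤ n, δ / M ≤ Pmat G m z x := by
      have hdM : δ / M ≤ δ := div_le_self hδ0.le hM0
      rcases (Finset.mem_filter.mp hx).2 with h | h
      · subst h
        refine ⟨0, Nat.zero_le _, ?_⟩
        rw [P_zero, if_pos rfl]; linarith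
      · unfold auxG at h
        rw [SimpleGraph.fromRel_adj] at h
        rcases h.2 with ⟨m, hm, h'⟩ | ⟨m, hm, h'⟩
        · exact ⟨m, hm, hdM.trans h'⟩
        · refine ⟨m, hm, ?_⟩
          have hr := P_rev G hd m z x
          have hz : (G.degree z : ℝ) ≤ M := by exact_mod_cast hM z
          have hx1 : (1:ℝ) ≤ G.degree x := by exact_mod_cast hd x
          have hP := P_nonneg G m z x
          rw [div_le_iff₀ (by linarith)]
          nlinarith
    obtain ⟨m, hm, h⟩ := hex
    exact h.trans (Finset.single_le_sum (f := fun m => Pmat G m z x)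
      (fun m _ => P_nonneg G m z x) (Finset.mem_range.mpr (by omega)))
  have h1 := Finset.card_nsmul_le_sum _ _ _ key
  rw [nsmul_eq_mul] at h1
  have h2 : ∑ x ∈ (Finset.univ.filter (fun x => x = z ∨ (auxG G n δ).Adj z x)),
      ∑ m ∈ Finset.range (n+1), Pmat G m z x ≤ n + 1 := by
    refine (Finset.sum_le_sum_of_subset_of_nonneg (Finset.filter_subset _ _)
      (fun x _ _ => Finset.sum_nonneg fun m _ => P_nonneg G m z x)).trans ?_
    rw [Finset.sum_comm]
    simp [sum_P G hd]
  have h3 := h1.trans h2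
  rw [← mul_div_assoc, div_le_iff₀ (by linarith)] at h3
  rw [le_div_iff₀ hδ0]
  exact h3

theorem trunc (hd : ∀ x, 0 < G.degree x) (n : ℕ) (τ : ℝ) (hτ : τ ≤ 1/4)
    (hTV : ∀ x y, G.Adj x y → ∑ z, |Pmat G n x z - Pmat G n y z| ≤ 2 * τ)
    (A B : V → V → Prop) (hA : ∀ x, inP G (A x) n x ≤ τ) (hB : ∀ x, inP G (B x) n x ≤ τ)
    (p : V → V → ℝ) (hp : p = fun x z => if A x z ∨ B x z then 0 else Pmat G n x z) :
    (∀ x z, 0 ≤ p x z) ∧ (∀ x z, p x z ≤ 1) ∧ (∀ x, 1/2 ≤ ∑ z, p x z) ∧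
    (∀ x y, G.Adj x y → ∑ z, |p x z - p y z| ≤ 6 * τ) := by
  have hle : ∀ x z, p x z ≤ Pmat G n x z := by
    intro x z
    rw [hp]; dsimp only
    have := P_nonneg G n x z
    split_ifs <;> linarith
  have hdiff : ∀ x, ∑ z, (Pmat G n x z - p x z) ≤ 2 * τ := by
    intro x
    have : ∑ z, (Pmat G n x z - p x z) ≤ inP G (A x) n x + inP G (B x) n x := by
      unfold inP
      rw [← Finset.sum_add_distrib]
      refine Finset.sum_le_sum fun z _ => ?_
      rw [hp]; dsimp only
      have := P_nonneg G n x z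
      by_cases h1 : A x z <;> by_cases h2 : B x z <;> simp [h1, h2] <;> linarith
    linarith [hA x, hB x]
  refine ⟨?_, fun x z => (hle x z).trans (P_le_one G hd n x z), ?_, ?_⟩
  · intro x z
    rw [hp]; dsimp only
    have := P_nonneg G n x z
    split_ifs <;> linarith
  · intro x
    have := hdiff x
    rw [Finset.sum_sub_distrib, sum_P G hd] at this
    linarith
  · intro x y h
    have h1 : ∑ z, |p x z - p y z| ≤ ∑ z, (|Pmat G n x z - Pmat G n y z| +
        (Pmat G n x z - p x z) + (Pmat G n y z - p y z)) := by
      refine Finset.sum_le_sum fun z _ => ?_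
      have a := hle x z
      have b := hle y z
      have c := le_abs_self (Pmat G n x z - Pmat G n y z)
      have d := neg_abs_le (Pmat G n x z - Pmat G n y z)
      rw [abs_le]; constructor <;> linarith
    rw [Finset.sum_add_distrib, Finset.sum_add_distrib] at h1
    linarith [hTV x y h, hdiff x, hdiff y]

end final

theorem main_aux (M : ℕ) (ε : ℝ) (hε : 0 < ε) (hε1 : ε < 1) (V : Type) [Fintype V]
    (G : SimpleGraph V) [G.LocallyFinite] (hc : G.Connected) (hM : ∀ v : V, G.degree v ≤ M)
    (n : ℕ) (hn : 1 ≤ n) (hT : 0 < TV G n) (C : ℝ) (hC : C = 64 * (M + 1)) :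
      ∃ P : Finset (Finset V),
        (∀ W ∈ P, W.Nonempty) ∧
        (∀ v : V, ∃! W : Finset V, W ∈ P ∧ v ∈ W) ∧
        (∀ W ∈ P,
          (∀ x ∈ W, ∀ y ∈ W,
            (G.dist x y : ℝ) ≤ min (2 * (n : ℝ)) (C * Dstar G n * Real.log (1 / TV G n))) ∧
          Real.log (W.card : ℝ)
            ≤ min (2 * (M : ℝ) * (n : ℝ))
                (C * (Hstar G n + Real.log n) * Real.log (1 / TV G n))) ∧
        ∑ W ∈ P.filter
            (fun W => C * ε⁻¹ * TV G n * (degSum G W : ℝ) < (boundaryCard G W : ℝ)),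
            (degSum G W : ℝ)
          ≤ ε * (degSum G Finset.univ : ℝ) := by
  obtain ⟨x₀, y₀, hxy⟩ := exists_adj G n hT
  have : Nontrivial V := ⟨x₀, y₀, hxy.ne⟩
  have hd : ∀ x, 0 < G.degree x := fun x => hc.preconnected.degree_pos_of_nontrivial x
  have hM1 : (1:ℝ) ≤ M := by exact_mod_cast (hd x₀).trans_le (hM x₀)
  have hD := Dstar_ge G hd hc n hn x₀
  have hH := Hstar_ge G hd n hn x₀
  have hlog2 : (1/2:ℝ) < Real.log 2 := by linarith [Real.log_two_gt_d9]
  have hn1 : (1:ℝ) ≤ n := by exact_mod_cast hn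
  have hlogn : 0 ≤ Real.log n := Real.log_nonneg hn1
  have hT1 := TV_le_one G hd n
  have hl0 : 0 ≤ Real.log (1 / TV G n) := Real.log_nonneg (by rw [le_div_iff₀ hT]; linarith)
  have hC0 : 0 < C := by rw [hC]; linarith
  have hεinv : 1 ≤ ε⁻¹ := (one_le_inv₀ hε).mpr hε1.le
  set τ := TV G n with hτ
  rcases le_or_gt (1/4) τ with hbig | hsmall
  · -- singletons
    refine ⟨Finset.univ.image (fun v => {v}), ?_, ?_, ?_, ?_⟩
    · intro W hW
      obtain ⟨v, _, rfl⟩ := Finset.mem_image.mp hW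
      simp
    · intro v
      refine ⟨{v}, by simp, ?_⟩
      rintro W ⟨hW, hv⟩
      obtain ⟨u, _, rfl⟩ := Finset.mem_image.mp hW
      simp at hv
      rw [hv]
    · intro W hW
      obtain ⟨v, _, rfl⟩ := Finset.mem_image.mp hW
      constructor
      · intro x hx y hy
        simp at hx hy
        subst hx; subst hy
        simp only [SimpleGraph.dist_self, Nat.cast_zero]
        exact le_min (by linarith)
          (mul_nonneg (mul_nonneg hC0.le (by linarith)) hl0)
      · simp only [Finset.card_singleton, Nat.cast_one, Real.log_one]
        exact le_min (by positivity)
          (mul_nonneg (mul_nonneg hC0.le (by linarith)) hl0)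
    · rw [Finset.filter_eq_empty_iff.mpr]
      · simp; positivity
      · intro W _
        rw [not_lt, boundary_eq]
        refine (eAB_le_deg G W _).trans ?_
        have h1 : 1 ≤ C * ε⁻¹ * τ := by
          have : 4 ≤ C := by rw [hC]; linarith
          have : 4 ≤ C * ε⁻¹ := by nlinarith
          nlinarith
        exact le_mul_of_one_le_left (by positivity) h1
  · have hl1 : 1 ≤ Real.log (1 / τ) := by
      have h4 : Real.log 4 ≤ Real.log (1/τ) :=
        Real.log_le_log (by norm_num) (by rw [le_div_iff₀ hT]; linarith)
      have : Real.log 4 = 2 * Real.log 2 := by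
        rw [show (4:ℝ) = 2^2 by norm_num, Real.log_pow]; norm_num
      linarith
    set ℓ := Real.log (1 / τ) with hℓ
    set D := Dstar G n
    set H := Hstar G n
    let k := ⌈ℓ⌉₊
    have hk1 : ℓ ≤ k := Nat.le_ceil _
    have hk2 : (k:ℝ) ≤ 2 * ℓ := by
      have := Nat.ceil_lt_add_one hl0
      change (k:ℝ) < _ at this
      linarith
    have hkτ : (1/3:ℝ)^k ≤ τ := by
      have h1 : (1/3:ℝ) ≤ Real.exp (-1) := by
        rw [Real.exp_neg, ← one_div]
        exact one_div_le_one_div_of_le (Real.exp_pos _) Real.exp_one_lt_three.le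
      have h2 : (1/3:ℝ)^k ≤ Real.exp (-1) ^ k := pow_le_pow_left₀ (by norm_num) h1 k
      rw [← Real.exp_nat_mul] at h2
      refine h2.trans ?_
      rw [← Real.le_log_iff_exp_le hT]
      rw [one_div, Real.log_inv] at hℓ
      linarith
    let b := ⌈4 * D⌉₊
    have hb1 : 4 * D ≤ b := Nat.le_ceil _
    have hb2 : (b:ℝ) ≤ 6 * D := by
      have := Nat.ceil_lt_add_one (show 0 ≤ 4 * D by linarith)
      change (b:ℝ) < _ at this
      linarith
    let L : ℝ := 4 * H + Real.log (2 * M)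
    have hlogM : 0 ≤ Real.log M := Real.log_nonneg hM1
    have hlog2M : Real.log (2 * M) = Real.log 2 + Real.log M :=
      Real.log_mul (by norm_num) (by linarith)
    have hL4 : 4 * H ≤ L := by simp only [L]; linarith
    have hδ : Real.exp (-L) ≤ 1 / (2 * M) := by
      rw [← Real.le_log_iff_exp_le (by positivity), one_div, Real.log_inv]
      simp only [L]; linarith
    have hδ1 : Real.exp (-L) ≤ 1 := by
      rw [Real.exp_le_one_iff]; simp only [L]; linarith
    let G' := auxG G n (Real.exp (-L))
    have hle : G ≤ G' := le_auxG G M n _ hn hd hM hδ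
    have hc' : G'.Connected := hc.mono hle
    have t1 : ∀ x, inP G (fun z => k * (2*b) ≤ G.dist x z) n x ≤ τ := fun x =>
      (tail G G hd le_rfl hc n b (markov_dist G hd hc n b hn hb1) x k).trans hkτ
    have t2 : ∀ x, inP G (fun z => k * (2*2) ≤ G'.dist x z) n x ≤ τ := fun x =>
      (tail G G' hd hle hc' n 2 (markov_ent G hd n hn L hL4) x k).trans hkτ
    obtain ⟨p, hp⟩ : ∃ p : V → V → ℝ, p = fun x z =>
      if k * (2*b) ≤ G.dist x z ∨ k * (2*2) ≤ G'.dist x z then 0 else Pmat G n x z := ⟨_, rfl⟩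
    obtain ⟨q0, q1, q2, q3⟩ := trunc G hd n τ hsmall.le (fun x y h => TV_ge G n x y h)
      (fun x z => k * (2*b) ≤ G.dist x z) (fun x z => k * (2*2) ≤ G'.dist x z) t1 t2 p (by
        rw [hp]; funext x z; congr)
    have hpp : ∀ x z, 0 < p x z → G.dist x z ≤ n ∧ G.dist x z ≤ k * (2*b) ∧
        G'.dist x z ≤ 4 * k := by
      intro x z h
      rw [hp] at h
      dsimp only at h
      split_ifs at h with h'
      · exact absurd h (lt_irrefl _)
      · push Not at h'
        exact ⟨P_pos_dist G hc n x z h, h'.1.le, by omega⟩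
    obtain ⟨P, hP1, hP2, hP3, hP4⟩ := greedy G hd p τ hT q0 q1 q2 q3 _ Finset.univ le_rfl
    refine ⟨P, fun W hW => (hP1 W hW).1, fun v => hP2 v (Finset.mem_univ v), ?_, ?_⟩
    · intro W hW
      obtain ⟨hne, -, z, hz⟩ := hP1 W hW
      constructor
      · intro x hx y hy
        have hx' := hpp x z (hz x hx)
        have hy' := hpp y z (hz y hy)
        have htri := hc.dist_triangle (u := x) (v := z) (w := y)
        rw [SimpleGraph.dist_comm (u := z)] at htri
        refine le_min ?_ ?_
        · have : G.dist x y ≤ 2 * n := by omega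
          exact_mod_cast this
        · have h1 : G.dist x y ≤ 4 * (k * b) := by
            have : k * (2 * b) = 2 * (k * b) := by ring
            omega
          have h2 : (G.dist x y : ℝ) ≤ 4 * (k * b) := by exact_mod_cast h1
          have h3 : (k:ℝ) * b ≤ (2 * ℓ) * (6 * D) :=
            mul_le_mul hk2 hb2 (Nat.cast_nonneg _) (by linarith)
          have h4 : 0 ≤ D * ℓ := mul_nonneg (by linarith) hl0
          have h5 : 48 * (D * ℓ) ≤ C * (D * ℓ) :=
            mul_le_mul_of_nonneg_right (by rw [hC]; linarith) h4
          linarith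
      · have hcpos : (0:ℝ) < W.card := by exact_mod_cast hne.card_pos
        refine le_min ?_ ?_
        · have h1 := ball_card G hc (M+1) (by linarith) (by
            intro u
            have : (Finset.univ.filter (fun x => x = u ∨ G.Adj u x)) ⊆
                insert u (G.neighborFinset u) := by
              intro x hx
              simpa using hx
            have h2 := (Finset.card_le_card this).trans (Finset.card_insert_le _ _)
            rw [SimpleGraph.card_neighborFinset_eq_degree] at h2
            have := hM u
            have h3 : (Finset.univ.filter (fun x => x = u ∨ G.Adj u x)).card ≤ M + 1 := by omega
            exact_mod_cast h3) z n
          have hsub : W ⊆ Finset.univ.filter (fun x => G.dist z x ≤ n) := by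
            intro x hx
            have := (hpp x z (hz x hx)).1
            rw [SimpleGraph.dist_comm] at this
            simpa using this
          have h2 : (W.card : ℝ) ≤ (M+1:ℝ)^n :=
            le_trans (by exact_mod_cast Finset.card_le_card hsub) h1
          have h3 := Real.log_le_log hcpos h2
          rw [Real.log_pow] at h3
          have h4 := Real.log_le_sub_one_of_pos (show (0:ℝ) < M+1 by linarith)
          have h5 := mul_le_mul_of_nonneg_left h4 (show (0:ℝ) ≤ n by linarith)
          have h6 : 0 ≤ (M:ℝ) * n := by positivity
          linarith
        · have hKpos : (0:ℝ) < (n+1) * M / Real.exp (-L) := by positivity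
          have h1 := ball_card G' hc' _ hKpos.le
            (aux_deg G M n _ (Real.exp_pos _) hδ1 hd hM) z (4*k)
          have hsub : W ⊆ Finset.univ.filter (fun x => G'.dist z x ≤ 4*k) := by
            intro x hx
            have := (hpp x z (hz x hx)).2.2
            rw [SimpleGraph.dist_comm] at this
            simpa using this
          have h2' : (W.card : ℝ) ≤ ((Finset.univ.filter (fun x => G'.dist z x ≤ 4*k)).card : ℝ) := by
            exact_mod_cast Finset.card_le_card hsub
          have h2 := h2'.trans h1
          have h3 := Real.log_le_log hcpos h2
          rw [Real.log_pow, Real.log_div (by positivity) (Real.exp_ne_zero _), Real.log_exp,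
            Real.log_mul (by positivity) (by positivity)] at h3
          have h4 : Real.log (n+1) ≤ Real.log 2 + Real.log n := by
            rw [← Real.log_mul (by norm_num) (by linarith)]
            exact Real.log_le_log (by linarith) (by linarith)
          have h5 := Real.log_le_sub_one_of_pos (show (0:ℝ) < M by linarith)
          have h7 : (M:ℝ) ≤ 4 * M * H := by nlinarith
          have h6 : Real.log (n+1) + Real.log M - -L ≤ (8 + 8 * M) * (H + Real.log n) := by
            simp only [L]
            rw [hlog2M]
            have : 0 ≤ (M:ℝ) * Real.log n := by positivity
            nlinarith
          have hX : 0 ≤ (8 + 8 * (M:ℝ)) * (H + Real.log n) :=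
            mul_nonneg (by linarith) (by linarith)
          have h8 : ((4 * k : ℕ) : ℝ) ≤ 8 * ℓ := by push_cast; linarith
          have h9 : ((4 * k : ℕ) : ℝ) * (Real.log (n+1) + Real.log M - -L) ≤
              (8 * ℓ) * ((8 + 8 * M) * (H + Real.log n)) :=
            (mul_le_mul_of_nonneg_left h6 (Nat.cast_nonneg _)).trans
              (mul_le_mul_of_nonneg_right h8 hX)
          refine (h3.trans h9).trans (le_of_eq ?_)
          rw [hC]; ring
    · have hcτ : 0 < C * ε⁻¹ * τ := by positivity
      have h1 : C * ε⁻¹ * τ * ∑ W ∈ P.filter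
            (fun W => C * ε⁻¹ * τ * (degSum G W : ℝ) < (boundaryCard G W : ℝ)),
            (degSum G W : ℝ) ≤ ∑ W ∈ P, eAB G W (Finset.univ \ W) := by
        rw [Finset.mul_sum]
        refine (Finset.sum_le_sum (g := fun W => eAB G W (Finset.univ \ W)) ?_).trans
          (Finset.sum_le_sum_of_subset_of_nonneg (Finset.filter_subset _ _) ?_)
        · intro W hW
          rw [← boundary_eq]
          exact (Finset.mem_filter.mp hW).2.le
        · intro W _ _
          rw [← boundary_eq]
          positivity
      have h2 : 26 * τ * (degSum G Finset.univ : ℝ) ≤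
          C * ε⁻¹ * τ * (ε * (degSum G Finset.univ : ℝ)) := by
        have e : C * ε⁻¹ * τ * (ε * (degSum G Finset.univ : ℝ)) =
          C * (τ * (degSum G Finset.univ : ℝ)) := by field_simp
        rw [e]
        have : 26 * (τ * (degSum G Finset.univ : ℝ)) ≤ C * (τ * (degSum G Finset.univ : ℝ)) :=
          mul_le_mul_of_nonneg_right (by rw [hC]; linarith) (by positivity)
        linarith
      exact le_of_mul_le_mul_left (h1.trans (hP4.trans h2)) hcτ

/-- partition version of Statement 0 for finite graphs: the vertex set can be
partitioned into cells of controlled diameter and volume so that all but an `ε`-fraction of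
the total degree lies in cells of boundary-to-volume ratio `O(ε⁻¹ TV_n)`. -/
theorem statement16 (M : ℕ) (ε : ℝ) (hε : 0 < ε) (hε1 : ε < 1) :
    ∃ C : ℝ, ∀ (V : Type) [Fintype V] (G : SimpleGraph V) [G.LocallyFinite],
      G.Connected →
      (∀ v : V, G.degree v ≤ M) →
      ∀ n : ℕ, 1 ≤ n → 0 < TV G n →
      ∃ P : Finset (Finset V),
        (∀ W ∈ P, W.Nonempty) ∧
        -- P is a partition of V: every vertex lies in exactly one cell
        (∀ v : V, ∃! W : Finset V, W ∈ P ∧ v ∈ W) ∧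
        (∀ W ∈ P,
          (∀ x ∈ W, ∀ y ∈ W,
            (G.dist x y : ℝ) ≤ min (2 * (n : ℝ)) (C * Dstar G n * Real.log (1 / TV G n))) ∧
          Real.log (W.card : ℝ)
            ≤ min (2 * (M : ℝ) * (n : ℝ))
                (C * (Hstar G n + Real.log n) * Real.log (1 / TV G n))) ∧
        -- total degree of vertices in bad cells is at most ε · deg(V)
        ∑ W ∈ P.filter
            (fun W => C * ε⁻¹ * TV G n * (degSum G W : ℝ) < (boundaryCard G W : ℝ)),
            (degSum G W : ℝ)
          ≤ ε * (degSum G Finset.univ : ℝ) := by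
  refine ⟨64 * (M + 1), ?_⟩
  intro V _ G _ hc hM n hn hT
  exact main_aux M ε hε hε1 V G hc hM n hn hT _ rfl


end LazyRW
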